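/- arXiv:2403.16882 — 2 statements merged into one kernel-verified Lean document; each statement's English description precedes it below -/
import Mathlib

section
/- Reduction to the Chandrashekar flux for constant specific heat: fix constants k, m > 0 and γ > 1, set c_v := (k/m)/(γ − 1), and take ε(T) := c_v·T and η(T) := c_v·ln T. Then for any two states with ρ₋, ρ₊, T₋, T₊ > 0, ρ₋ ≠ ρ₊ and T₋ ≠ T₊, the energy component of the numerical flux in the y-direction satisfies G_E = G_ρ·((k/m)·(1/(γ − 1))·{{T}}_geo²/{{T}}_log − ({{vx²}} + {{vy²}})/2) + {{vx}}·G_ρvx + {{vy}}·G_ρvy. -/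
/-- Jump `⟦a⟧ := a₊ − a₋`. -/
def jump (am ap : ℝ) : ℝ := ap - am

/-- Arithmetic mean `{{a}} := (a₋ + a₊)/2`. -/
noncomputable def avg (am ap : ℝ) : ℝ := (am + ap) / 2

/-- Geometric mean `{{a}}_geo := √(a₋·a₊)` (for `a₋, a₊ > 0`). -/
noncomputable def geoMean (am ap : ℝ) : ℝ := Real.sqrt (am * ap)

/-- Logarithmic mean `{{a}}_log := (a₊ − a₋)/(ln a₊ − ln a₋)` (for `a₋, a₊ > 0`,
`a₋ ≠ a₊`). -/
noncomputable def logMean (am ap : ℝ) : ℝ := (ap - am) / (Real.log ap - Real.log am)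

/-- Reduction to the Chandrashekar flux for constant specific heat: with
`c_v = (k/m)/(γ−1)`, `ε(T) = c_v·T`, `η(T) = c_v·ln T`, the energy component of the
numerical flux in the y-direction takes Chandrashekar's form. -/
theorem ec_flux_chandrashekar_reduction (k m γ : ℝ) (hk : 0 < k) (hm : 0 < m) (hγ : 1 < γ)
    (ρm ρp vxm vxp vym vyp Tm Tp : ℝ)
    (hρm : 0 < ρm) (hρp : 0 < ρp) (hTm : 0 < Tm) (hTp : 0 < Tp)
    (hρ : ρm ≠ ρp) (hT : Tm ≠ Tp) :
    let c_v : ℝ := (k / m) / (γ - 1)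
    let ε : ℝ → ℝ := fun T => c_v * T
    let η : ℝ → ℝ := fun T => c_v * Real.log T
    let Grho : ℝ := logMean ρm ρp * avg vym vyp
    let Grvx : ℝ := Grho * avg vxm vxp
    let Grvy : ℝ := Grho * avg vym vyp + (k / m) * avg ρm ρp / avg (1 / Tm) (1 / Tp)
    let GE : ℝ :=
      Grho * geoMean Tm Tp ^ 2 *
          (jump (η Tm) (η Tp) / jump Tm Tp -
            avg (1 / Tm) (1 / Tp) * jump (ε Tm) (ε Tp) / jump Tm Tp) +
        Grho * (avg (ε Tm) (ε Tp) - (avg (vxm ^ 2) (vxp ^ 2) + avg (vym ^ 2) (vyp ^ 2)) / 2) +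
        avg vxm vxp * Grvx + avg vym vyp * Grvy
    GE =
      Grho * ((k / m) * (1 / (γ - 1)) * geoMean Tm Tp ^ 2 / logMean Tm Tp -
          (avg (vxm ^ 2) (vxp ^ 2) + avg (vym ^ 2) (vyp ^ 2)) / 2) +
        avg vxm vxp * Grvx + avg vym vyp * Grvy := by
  intro c_v ε η Grho Grvx Grvy GE
  have hd : Tp - Tm ≠ 0 := sub_ne_zero.mpr hT.symm
  have hg : geoMean Tm Tp ^ 2 = Tm * Tp := Real.sq_sqrt (mul_pos hTm hTp).le
  have key : geoMean Tm Tp ^ 2 * (jump (η Tm) (η Tp) / jump Tm Tp -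
      avg (1 / Tm) (1 / Tp) * jump (ε Tm) (ε Tp) / jump Tm Tp) + avg (ε Tm) (ε Tp)
      = (k / m) * (1 / (γ - 1)) * geoMean Tm Tp ^ 2 / logMean Tm Tp := by
    have hc : (k / m) * (1 / (γ - 1)) = c_v := by simp only [c_v]; ring
    rw [hc, hg]
    simp only [ε, η, jump, avg, logMean]
    generalize c_v = c
    rw [div_div_eq_mul_div]
    field_simp
    ring
  simp only [GE]
  linear_combination Grho * key
end

section
/- Expansion of the jump of the first entropy variable: fix constants k, m > 0 and functions ε, η : ℝ → ℝ. For any two states (ρ₋, vx₋, vy₋, T₋), (ρ₊, vx₊, vy₊, T₊) with ρ₋, ρ₊, T₋, T₊ > 0 and ρ₋ ≠ ρ₊, define ω₁± := −η(T±) + (k/m)·ln ρ± + (ε(T±) − (vx±² + vy±²)/2)/T±. Then ⟦ω₁⟧ = −⟦η(T)⟧ + (k/m)·⟦ρ⟧/{{ρ}}_log − ({{ε(T)}}/{{T}}_geo²)·⟦T⟧ + {{1/T}}·⟦ε(T)⟧ + (({{vx²}} + {{vy²}})/(2·{{T}}_geo²))·⟦T⟧ − {{1/T}}·{{vx}}·⟦vx⟧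 − {{1/T}}·{{vy}}·⟦vy⟧. -/
/-- Expansion of the jump of the first entropy variable
`ω₁ = −η(T) + (k/m)·ln ρ + (ε(T) − (vx² + vy²)/2)/T` in terms of jumps of the
primitive variables. -/
theorem jump_omega1_expansion (ε η : ℝ → ℝ) (k m : ℝ) (hk : 0 < k) (hm : 0 < m)
    (ρm ρp vxm vxp vym vyp Tm Tp : ℝ)
    (hρm : 0 < ρm) (hρp : 0 < ρp) (hTm : 0 < Tm) (hTp : 0 < Tp) (hρ : ρm ≠ ρp) :
    let ω1m : ℝ := -η Tm + (k / m) * Real.log ρm + (ε Tm - (vxm ^ 2 + vym ^ 2) / 2) / Tm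
    let ω1p : ℝ := -η Tp + (k / m) * Real.log ρp + (ε Tp - (vxp ^ 2 + vyp ^ 2) / 2) / Tp
    jump ω1m ω1p =
      -jump (η Tm) (η Tp) + (k / m) * jump ρm ρp / logMean ρm ρp -
        (avg (ε Tm) (ε Tp) / geoMean Tm Tp ^ 2) * jump Tm Tp +
        avg (1 / Tm) (1 / Tp) * jump (ε Tm) (ε Tp) +
        ((avg (vxm ^ 2) (vxp ^ 2) + avg (vym ^ 2) (vyp ^ 2)) / (2 * geoMean Tm Tp ^ 2)) *
          jump Tm Tp -
        avg (1 / Tm) (1 / Tp) * avg vxm vxp * jump vxm vxp -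
        avg (1 / Tm) (1 / Tp) * avg vym vyp * jump vym vyp := by
  intro ω1m ω1p
  have hg : geoMean Tm Tp ^ 2 = Tm * Tp := by
    unfold geoMean
    exact Real.sq_sqrt (mul_pos hTm hTp).le
  have hd : ρp - ρm ≠ 0 := sub_ne_zero.mpr (Ne.symm hρ)
  have hl : (k / m) * jump ρm ρp / logMean ρm ρp
      = (k / m) * (Real.log ρp - Real.log ρm) := by
    unfold jump logMean
    rw [mul_div_assoc, div_div_cancel₀ hd]
  rw [hg, hl]
  simp only [ω1m, ω1p, jump, avg]
  have h1 := hTm.ne'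
  have h2 := hTp.ne'
  have h3 := hm.ne'
  field_simp
  ring
end
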